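/- Let p be a prime and let f(x) ∈ 𝔽_p[x] be a polynomial of degree d with 0 < d < p. Let D ⊆ 𝔽_p with |D| = p - c, and assume p - c ≥ (d-1)√p + c. Then for every b ∈ 𝔽_p and every 0 ≤ k ≤ |D|, |N_f(D,k,b) - (1/p)·C(p-c, k)| ≤ C((d-1)·p^{1/2} + c + k, k). -/

import Mathlib

open Finset

/-- `N_f(D, k, b)`: the number of `k`-element subsets `S ⊆ D` with `∑_{x ∈ S} f(x) = b`. -/
def polySubsetSumCount {R : Type*} [CommRing R] [DecidableEq R]
    (D : Finset R) (f : Polynomial R) (k : ℕ) (b : R) : ℕ :=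
  ((D.powersetCard k).filter (fun S => ∑ x ∈ S, f.eval x = b)).card

/-- The real "binomial coefficient" `C(x, k) = x(x-1)⋯(x-k+1)/k!`. -/
noncomputable def realChoose (x : ℝ) (k : ℕ) : ℝ :=
  (∏ j ∈ Finset.range k, (x - j)) / (Nat.factorial k)

section ArtinSchreierWeights

open Polynomial

variable {K : Type*} [Field K]

/-- The bivariate polynomials all of whose monomials `x ^ i * y ^ j` have weight
`p * i + d * j ≤ n`. -/
def weightLE (K : Type*) [Field K] (p d n : ℕ) : Submodule K K[X][X] where
  carrier := {H | ∀ j i, p * i + d * j ≤ n ∨ (H.coeff j).coeff i = 0}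
  zero_mem' := fun j i => by simp
  add_mem' := by
    intro H G hH hG j i
    rcases hH j i with h | h
    · exact Or.inl h
    rcases hG j i with h' | h'
    · exact Or.inl h'
    · exact Or.inr (by simp [h, h'])
  smul_mem' := by
    intro c H hH j i
    rcases hH j i with h | h
    · exact Or.inl h
    · exact Or.inr (by simp [h])

theorem weightLE_mono {p d m n : ℕ} (h : m ≤ n) : weightLE K p d m ≤ weightLE K p d n :=
  fun _ hH j i => (hH j i).imp_left fun h' => h'.trans h

/-- The bivariate monomial `x ^ i * y ^ j`. -/
noncomputable def biMonomial (K : Type*) [Field K] (i j : ℕ) : K[X][X] :=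
  monomial j (monomial i 1)

theorem evalEval_biMonomial (i j : ℕ) (x y : K) :
    (biMonomial K i j).evalEval x y = x ^ i * y ^ j := by
  simp [biMonomial, evalEval, eval_monomial]

theorem biMonomial_mem_weightLE (p d i j : ℕ) : biMonomial K i j ∈ weightLE K p d (p * i + d * j) := by
  intro j' i'
  by_cases h : j = j' ∧ i = i'
  · left; rw [h.1, h.2]
  · right
    simp only [biMonomial, coeff_monomial]
    split_ifs with h1
    · rw [coeff_monomial, if_neg (fun h2 => h ⟨h1, h2⟩)]
    · simp

/-- The polynomial `y ^ p - y - f(x)` in `K[x][y]`. -/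
noncomputable def artinSchreierPoly (p : ℕ) (f : K[X]) : K[X][X] := X ^ p - X - C f

theorem artinSchreierPoly_eq (p : ℕ) (f : K[X]) :
    artinSchreierPoly p f = X ^ p - (X + C f) := by rw [artinSchreierPoly, sub_sub]

theorem degree_X_add_C_lt {p : ℕ} (hp : 1 < p) (f : K[X]) :
    (X + C f : K[X][X]).degree < (p : WithBot ℕ) := by
  rw [degree_X_add_C]; exact_mod_cast hp

theorem artinSchreierPoly_monic {p : ℕ} (hp : 1 < p) (f : K[X]) :
    (artinSchreierPoly p f).Monic := by
  rw [artinSchreierPoly_eq]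
  exact monic_X_pow_sub (by rw [degree_X_add_C]; exact_mod_cast hp)

theorem degree_artinSchreierPoly {p : ℕ} (hp : 1 < p) (f : K[X]) :
    (artinSchreierPoly p f).degree = p := by
  rw [artinSchreierPoly_eq, degree_sub_eq_left_of_degree_lt, degree_X_pow]
  rw [degree_X_pow]; exact degree_X_add_C_lt hp f

/-- Reduction modulo `y ^ p - y - f(x)`, as a linear map over the constants. -/
noncomputable def artinSchreierReduce (p : ℕ) (f : K[X]) : K[X][X] →ₗ[K] K[X][X] :=
  (modByMonicHom (artinSchreierPoly p f)).restrictScalars K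

theorem artinSchreierReduce_apply (p : ℕ) (f : K[X]) (H : K[X][X]) :
    artinSchreierReduce p f H = H %ₘ artinSchreierPoly p f := rfl

theorem coeff_artinSchreierReduce {p : ℕ} (hp : 1 < p) (f : K[X]) (H : K[X][X]) {j : ℕ}
    (hj : p ≤ j) : (artinSchreierReduce p f H).coeff j = 0 := by
  refine coeff_eq_zero_of_degree_lt ((degree_modByMonic_lt _ (artinSchreierPoly_monic hp f)).trans_le ?_)
  rw [degree_artinSchreierPoly hp]
  exact_mod_cast hj

theorem evalEval_artinSchreierReduce {p : ℕ} (f : K[X]) (H : K[X][X])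
    {x y : K} (h : y ^ p - y = f.eval x) :
    (artinSchreierReduce p f H).evalEval x y = H.evalEval x y := by
  have h1 : (artinSchreierPoly p f).evalEval x y = 0 := by
    simp [artinSchreierPoly, h, evalEval_C]
  conv_rhs => rw [← modByMonic_add_div H (artinSchreierPoly p f)]
  rw [evalEval_add, evalEval_mul, h1, zero_mul, add_zero, artinSchreierReduce_apply]

theorem artinSchreierReduce_biMonomial_add {p : ℕ} (hp : 1 < p) (f : K[X]) (i j : ℕ) :
    artinSchreierReduce p f (biMonomial K i (j + p)) =
      artinSchreierReduce p f (biMonomial K i (j + 1)) +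
      ∑ k ∈ range (f.natDegree + 1),
        f.coeff k • artinSchreierReduce p f (biMonomial K (i + k) j) := by
  have hf : (∑ k ∈ range (f.natDegree + 1), f.coeff k • biMonomial K (i + k) j) =
      biMonomial K i j * C f := by
    conv_rhs => rw [f.as_sum_range' (f.natDegree + 1) (Nat.lt_succ_self _)]
    rw [map_sum, mul_sum]
    refine sum_congr rfl fun k _ => ?_
    simp [biMonomial, monomial_mul_C, monomial_mul_monomial, smul_monomial]
  have h : biMonomial K i (j + p) = biMonomial K i (j + 1) +
      ∑ k ∈ range (f.natDegree + 1), f.coeff k • biMonomial K (i + k) j +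
      artinSchreierPoly p f * biMonomial K i j := by
    rw [hf, artinSchreierPoly]
    have e : ∀ n, biMonomial K i (j + n) = X ^ n * biMonomial K i j := by
      intro n
      simp [biMonomial, X_pow_eq_monomial, monomial_mul_monomial, add_comm]
    rw [e, e, pow_one]
    ring
  have h0 : artinSchreierReduce p f (artinSchreierPoly p f * biMonomial K i j) = 0 := by
    rw [artinSchreierReduce_apply]
    exact (modByMonic_eq_zero_iff_dvd (artinSchreierPoly_monic hp f)).2 (dvd_mul_right _ _)
  rw [h, map_add, map_add, h0, add_zero, map_sum]
  simp only [map_smul]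

theorem artinSchreierReduce_biMonomial {p : ℕ} (hp : 1 < p) (f : K[X]) (hf : 0 < f.natDegree)
    (j : ℕ) : ∀ i, artinSchreierReduce p f (biMonomial K i j) ∈
      weightLE K p f.natDegree (p * i + f.natDegree * j) ∧
      ((artinSchreierReduce p f (biMonomial K i j)).coeff (j % p)).coeff
        (i + f.natDegree * (j / p)) ≠ 0 := by
  induction j using Nat.strong_induction_on with
  | _ j ih =>
  intro i
  rcases lt_or_ge j p with hj | hj
  · have h : artinSchreierReduce p f (biMonomial K i j) = biMonomial K i j := by
      rw [artinSchreierReduce_apply, modByMonic_eq_self_iff (artinSchreierPoly_monic hp f),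
        degree_artinSchreierPoly hp]
      exact (degree_monomial_le _ _).trans_lt (by exact_mod_cast hj)
    rw [h]
    refine ⟨biMonomial_mem_weightLE _ _ _ _, ?_⟩
    simp [Nat.mod_eq_of_lt hj, Nat.div_eq_of_lt hj, biMonomial]
  obtain ⟨j, rfl⟩ := Nat.exists_eq_add_of_le' hj
  have hp0 : 0 < p := by omega
  set d := f.natDegree with hd
  rw [artinSchreierReduce_biMonomial_add hp]
  have hw1 : p * i + d * (j + 1) < p * i + d * (j + p) := by
    have : d * (j + 1) < d * (j + p) := Nat.mul_lt_mul_of_pos_left (by omega) hf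
    omega
  have hwk : ∀ k < d, p * (i + k) + d * j < p * i + d * (j + p) := by
    intro k hk
    have : p * k < p * d := Nat.mul_lt_mul_of_pos_left hk hp0
    nlinarith
  have hwd : p * (i + d) + d * j = p * i + d * (j + p) := by ring
  constructor
  · refine Submodule.add_mem _ (weightLE_mono hw1.le (ih _ (by omega) i).1) ?_
    refine Submodule.sum_mem _ fun k hk => Submodule.smul_mem _ _ ?_
    rcases (Nat.lt_succ_iff.1 (mem_range.1 hk)).lt_or_eq with hk | rfl
    · exact weightLE_mono (hwk k hk).le (ih j (by omega) _).1
    · exact hwd ▸ (ih j (by omega) _).1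
  · have hpos : p * (i + d * ((j + p) / p)) + d * ((j + p) % p) = p * i + d * (j + p) := by
      conv_rhs => rw [← Nat.div_add_mod (j + p) p]
      ring
    have hvan : ∀ H ∈ weightLE K p d (p * i + d * (j + p) - 1),
        (H.coeff ((j + p) % p)).coeff (i + d * ((j + p) / p)) = 0 := by
      intro H hH
      rcases hH ((j + p) % p) (i + d * ((j + p) / p)) with h | h
      · omega
      · exact h
    rw [coeff_add, coeff_add, hvan _ (weightLE_mono (by omega) (ih _ (by omega) i).1), zero_add,
      sum_range_succ, coeff_add, coeff_add, hvan, zero_add, coeff_smul, coeff_smul, smul_eq_mul]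
    · refine mul_ne_zero (leadingCoeff_ne_zero.2 (by rintro rfl; simp at hd; omega)) ?_
      have := (ih j (by omega) (i + d)).2
      rw [Nat.add_mod_right, Nat.add_div_right _ hp0]
      convert this using 2
      ring
    · refine Submodule.sum_mem _ fun k hk => Submodule.smul_mem _ _ ?_
      have hk := hwk k (mem_range.1 hk)
      exact weightLE_mono (by omega) (ih j (by omega) _).1

theorem artinSchreierReduce_mem_weightLE {p : ℕ} (hp : 1 < p) (f : K[X]) (hf : 0 < f.natDegree)
    {ι : Type*} (s : Finset ι) (a : ι → K) (u v : ι → ℕ) (n : ℕ)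
    (h : ∀ t ∈ s, p * u t + f.natDegree * v t ≤ n) :
    artinSchreierReduce p f (∑ t ∈ s, a t • biMonomial K (u t) (v t)) ∈
      weightLE K p f.natDegree n := by
  rw [map_sum]
  refine Submodule.sum_mem _ fun t ht => ?_
  rw [map_smul]
  exact Submodule.smul_mem _ _
    (weightLE_mono (h t ht) (artinSchreierReduce_biMonomial hp f hf _ _).1)

end ArtinSchreierWeights

theorem exists_weight_coordinates {p d : ℕ} (hp : 1 < p) (hd : d.Coprime p) :
    ∃ u v : ℕ → ℕ, (∀ t, d * p ≤ t → p * u t + d * v t = t) ∧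
      ∀ i j, j < p → u (p * i + d * j) = i ∧ v (p * i + d * j) = j := by
  obtain ⟨e, -, he⟩ := Nat.exists_mul_mod_eq_one_of_coprime hd hp
  have he' : d * e ≡ 1 [MOD p] := by rw [Nat.ModEq, he, Nat.mod_eq_of_lt hp]
  refine ⟨fun t => (t - d * (t * e % p)) / p, fun t => t * e % p, fun t ht => ?_,
    fun i j hj => ?_⟩
  · have h1 : d * (t * e % p) ≤ t :=
      (Nat.mul_le_mul_left d (Nat.mod_lt _ (by omega)).le).trans ht
    have h2 : d * (t * e % p) ≡ t [MOD p] :=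
      calc d * (t * e % p) ≡ d * (t * e) [MOD p] := (Nat.mod_modEq _ _).mul_left _
        _ = t * (d * e) := by ring
        _ ≡ t * 1 [MOD p] := he'.mul_left _
        _ = t := mul_one t
    have h3 : p ∣ t - d * (t * e % p) := (Nat.modEq_iff_dvd' h1).1 h2
    change p * ((t - d * (t * e % p)) / p) + d * (t * e % p) = t
    rw [Nat.mul_div_cancel' h3]
    omega
  · have h : (p * i + d * j) * e % p = j := by
      have : (p * i + d * j) * e ≡ j [MOD p] :=
        calc (p * i + d * j) * e = p * (i * e) + j * (d * e) := by ring
          _ ≡ 0 + j * 1 [MOD p] :=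
            Nat.ModEq.add (Nat.modEq_zero_iff_dvd.2 (dvd_mul_right _ _)) (he'.mul_left _)
          _ = j := by ring
      rw [this, Nat.mod_eq_of_lt hj]
    simp only [h, and_true]
    rw [Nat.add_sub_cancel, Nat.mul_div_cancel_left _ (by omega)]

section Stepanov

open Polynomial

variable {K : Type*} [Field K]

/-- Siegel's lemma for Artin–Schreier reductions: more monomials than the weight bound admits
a linear relation modulo `y ^ p - y - f(x)`. -/
theorem exists_artinSchreierReduce_eq_zero {p : ℕ} (hp : 1 < p) (f : K[X]) (hf : 0 < f.natDegree)
    (hfp : f.natDegree.Coprime p) {ι : Type*} [Fintype ι] (u v : ι → ℕ) (n : ℕ)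
    (h : ∀ t, p * u t + f.natDegree * v t ≤ n) (hn : n + 1 < Fintype.card ι) :
    ∃ a : ι → K, a ≠ 0 ∧ artinSchreierReduce p f (∑ t, a t • biMonomial K (u t) (v t)) = 0 := by
  obtain ⟨U, V, -, hUV⟩ := exists_weight_coordinates hp hfp
  let Φ : (ι → K) →ₗ[K] K[X][X] := artinSchreierReduce p f ∘ₗ
    Fintype.linearCombination K (fun t => biMonomial K (u t) (v t))
  let Ψ : (ι → K) →ₗ[K] (Fin (n + 1) → K) := LinearMap.pi fun w =>
    (lcoeff K (U w)) ∘ₗ ((lcoeff K[X] (V w)).restrictScalars K) ∘ₗ Φ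
  have hker : LinearMap.ker Ψ ≠ ⊥ := LinearMap.ker_ne_bot_of_finrank_lt (by simpa using hn)
  obtain ⟨a, ha, ha0⟩ := Submodule.exists_mem_ne_zero_of_ne_bot hker
  refine ⟨a, ha0, ?_⟩
  have hΦ : Φ a = artinSchreierReduce p f (∑ t, a t • biMonomial K (u t) (v t)) := rfl
  rw [← hΦ]
  have hΨ : ∀ w : Fin (n + 1), ((Φ a).coeff (V w)).coeff (U w) = 0 := fun w =>
    congrFun (LinearMap.mem_ker.1 ha) w
  ext j i
  rw [coeff_zero, coeff_zero]
  rcases lt_or_ge j p with hj | hj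
  · have hmem : Φ a ∈ weightLE K p f.natDegree n := hΦ ▸
      artinSchreierReduce_mem_weightLE hp f hf univ a u v n fun t _ => h t
    rcases hmem j i with hw | hw
    · have := hΨ ⟨p * i + f.natDegree * j, by omega⟩
      simpa only [hUV i j hj] using this
    · exact hw
  · rw [hΦ, coeff_artinSchreierReduce hp f _ hj, coeff_zero]

theorem artinSchreierReduce_ne_zero {p : ℕ} (hp : 1 < p) (f : K[X]) (hf : 0 < f.natDegree)
    {ι : Type*} [Fintype ι] (u v : ι → ℕ)
    (h : Function.Injective fun t => p * u t + f.natDegree * v t) (a : ι → K) (ha : a ≠ 0) :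
    artinSchreierReduce p f (∑ t, a t • biMonomial K (u t) (v t)) ≠ 0 := by
  classical
  obtain ⟨t₀, ht₀⟩ := Function.ne_iff.1 ha
  obtain ⟨t, ht, hmax⟩ := (univ.filter fun t => a t ≠ 0).exists_max_image
    (fun t => p * u t + f.natDegree * v t) ⟨t₀, by simpa using ht₀⟩
  simp only [mem_filter, mem_univ, true_and] at ht hmax
  intro h0
  have h1 := congrArg (fun H : K[X][X] =>
    (H.coeff (v t % p)).coeff (u t + f.natDegree * (v t / p))) h0
  simp only [map_sum, map_smul, finsetSum_coeff, coeff_smul, smul_eq_mul, coeff_zero] at h1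
  rw [sum_eq_single t] at h1
  · exact mul_ne_zero ht (artinSchreierReduce_biMonomial hp f hf _ _).2 h1
  · intro s _ hst
    by_cases hs : a s = 0
    · rw [hs, zero_mul]
    have hlt : p * u s + f.natDegree * v s < p * u t + f.natDegree * v t :=
      lt_of_le_of_ne (hmax s hs) fun e => hst (h e)
    rcases (artinSchreierReduce_biMonomial hp f hf (v s) (u s)).1 (v t % p)
      (u t + f.natDegree * (v t / p)) with hw | hw
    · have : p * (u t + f.natDegree * (v t / p)) + f.natDegree * (v t % p) =
          p * u t + f.natDegree * v t := by
        conv_rhs => rw [← Nat.div_add_mod (v t) p]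
        ring
      omega
    · rw [hw, mul_zero]
  · simp

/-- A reduced bivariate polynomial vanishing at all points of `y ^ p - y = f(x)` above a set of
`x`-coordinates of size `N`, each having `p` points above it, has weight at least `p * N`. -/
theorem mul_card_le_of_evalEval_eq_zero {p : ℕ} [Fact p.Prime] [CharP K p]
    (f : K[X]) (R : K[X][X]) (d n : ℕ) (hR : R ≠ 0) (hdeg : ∀ j, p ≤ j → R.coeff j = 0)
    (hw : R ∈ weightLE K p d n) (Z : Finset K) (hZ : ∀ x ∈ Z, ∃ y, y ^ p - y = f.eval x)
    (h0 : ∀ x y, y ^ p - y = f.eval x → R.evalEval x y = 0) : p * Z.card ≤ n := by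
  obtain ⟨j, hj⟩ : ∃ j, R.coeff j ≠ 0 := by
    by_contra! h
    exact hR (by ext1 j; rw [h, coeff_zero])
  have hroot : ∀ x ∈ Z, (R.coeff j).eval x = 0 := by
    intro x hx
    obtain ⟨y, hy⟩ := hZ x hx
    have hp : p.Prime := Fact.out
    have hinj : Function.Injective fun c : Fin p => y + (c : ℕ) := by
      intro a b hab
      have := add_left_cancel hab
      exact Fin.ext (by simpa [Nat.ModEq, Nat.mod_eq_of_lt] using (CharP.natCast_eq_natCast K p).1 this)
    have hS : R.map (evalRingHom x) = 0 := by
      refine eq_zero_of_natDegree_lt_card_of_eval_eq_zero _ hinj (fun c => ?_) ?_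
      · have h2 : (y + (c : ℕ)) ^ p - (y + (c : ℕ)) = f.eval x := by
          have h3 : ((c : ℕ) : K) ^ p = (c : ℕ) := map_natCast (frobenius K p) c
          rw [add_pow_char, h3, ← hy, add_sub_add_right_eq_sub]
        have := h0 x _ h2
        rwa [← eval₂_evalRingHom, ← eval_map] at this
      · rw [Fintype.card_fin]
        refine (natDegree_map_le).trans_lt ?_
        by_contra! hle
        have h3 := hdeg _ hle
        rw [coeff_natDegree, leadingCoeff_eq_zero] at h3
        exact hR h3
    have := congrArg (fun q : K[X] => q.coeff j) hS
    simpa [coeff_map] using this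
  have hcard : Z.card ≤ (R.coeff j).natDegree := by
    by_contra! hlt
    exact hj (eq_zero_of_natDegree_lt_card_of_eval_eq_zero' _ Z hroot hlt)
  rcases hw j (R.coeff j).natDegree with h | h
  · exact (Nat.mul_le_mul_left p hcard).trans ((Nat.le_add_right _ _).trans h)
  · exact absurd h (by rwa [coeff_natDegree, leadingCoeff_eq_zero])

/-- Stepanov–Bombieri bound for the rational points of `y ^ p - y = f(x)`. -/
theorem mul_card_artinSchreier_le {p : ℕ} [Fact p.Prime] [CharP K p] [Fintype K] (μ : ℕ)
    (hK : Fintype.card K = (p ^ μ) ^ 2) (f : K[X]) (hf : 0 < f.natDegree)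
    (hfp : f.natDegree.Coprime p) (hμ : 2 * (f.natDegree * p) + 1 < p ^ μ) (Z : Finset K)
    (hZ : ∀ x ∈ Z, ∃ y, y ^ p - y = f.eval x) :
    p * Z.card ≤ (p ^ μ) ^ 2 + (3 * (f.natDegree * p) + 1) * p ^ μ := by
  have hp : 1 < p := (Fact.out : p.Prime).one_lt
  obtain ⟨U, V, hUV, -⟩ := exists_weight_coordinates hp hfp
  set d := f.natDegree with hd
  set c := d * p with hc
  set P := p ^ μ with hP
  let s : Fin P × Fin (P + c + 1) → ℕ := fun t => c + t.1
  let r : Fin P × Fin (P + c + 1) → ℕ := fun t => c + t.2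
  have hs : ∀ t, p * U (s t) + d * V (s t) = s t := fun t => hUV _ (Nat.le_add_right _ _)
  have hr : ∀ t, p * U (r t) + d * V (r t) = r t := fun t => hUV _ (Nat.le_add_right _ _)
  have hslt : ∀ t, s t + 1 ≤ c + P := fun t => by have := t.1.2; simp only [s]; omega
  have hrlt : ∀ t, r t + 1 ≤ c + (P + c + 1) := fun t => by have := t.2.2; simp only [r]; omega
  have hw1 : ∀ t, p * (P * U (s t) + U (r t)) + d * (P * V (s t) + V (r t)) = P * s t + r t := by
    intro t
    conv_rhs => rw [← hs t, ← hr t]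
    ring
  have hw2 : ∀ t, p * (U (s t) + P * U (r t)) + d * (V (s t) + P * V (r t)) = s t + P * r t := by
    intro t
    conv_rhs => rw [← hs t, ← hr t]
    ring
  obtain ⟨a, ha, hred⟩ := exists_artinSchreierReduce_eq_zero hp f hf hfp
    (fun t => P * U (s t) + U (r t)) (fun t => P * V (s t) + V (r t)) (P * (c + P) + 2 * c)
    (fun t => by
      rw [hw1]
      have h1 := Nat.mul_le_mul_left P (hslt t)
      have h2 := hrlt t
      rw [mul_add, mul_one] at h1
      omega)
    (by
      rw [Fintype.card_prod, Fintype.card_fin, Fintype.card_fin]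
      nlinarith)
  have hbij : Function.Bijective (iterateFrobenius K p μ) := bijective_iterateFrobenius K p μ
  choose b hb using fun t => hbij.2 (a t)
  have hb0 : b ≠ 0 := by
    rintro rfl
    refine ha (funext fun t => ?_)
    rw [← hb t]; simp
  set R := artinSchreierReduce p f (∑ t, b t • biMonomial K (U (s t) + P * U (r t))
    (V (s t) + P * V (r t))) with hR
  have hR0 : R ≠ 0 := by
    refine artinSchreierReduce_ne_zero hp f hf _ _ ?_ b hb0
    intro t t' h
    simp only [← hd, hw2] at h
    have h1 : (t.1 : ℕ) + P * (c + t.2) = t'.1 + P * (c + t'.2) := by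
      simp only [s, r] at h; omega
    have h2 := congrArg (· % P) h1
    simp only [Nat.add_mul_mod_self_left, Nat.mod_eq_of_lt (Fin.is_lt _)] at h2
    rw [h2] at h1
    have h3 := Nat.eq_of_mul_eq_mul_left (by omega) (Nat.add_left_cancel h1)
    exact Prod.ext (Fin.ext h2) (Fin.ext (Nat.add_left_cancel h3))
  have hRw : R ∈ weightLE K p d (P ^ 2 + (3 * c + 1) * P) := by
    refine artinSchreierReduce_mem_weightLE hp f hf univ b _ _ _ fun t _ => ?_
    rw [← hd, hw2]
    have h1 := hslt t
    have h2 := Nat.mul_le_mul_left P (hrlt t)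
    nlinarith
  refine mul_card_le_of_evalEval_eq_zero f R d _ hR0
    (fun j hj => coeff_artinSchreierReduce hp f _ hj) hRw Z hZ fun x y hxy => ?_
  have hfin : ∀ z : K, (z ^ P) ^ P = z := fun z => by
    rw [← pow_mul, ← sq, ← hK, FiniteField.pow_card]
  have hpow : ∀ (z : K) (i k : ℕ), (z ^ (i + P * k)) ^ P = z ^ (P * i + k) := fun z i k => by
    rw [pow_add, mul_pow, ← pow_mul, mul_comm i, mul_comm P k, pow_mul z k, hfin, ← pow_add]
  have h1 := congrArg (fun H : K[X][X] => H.evalEval x y) hred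
  simp only [evalEval_artinSchreierReduce f _ hxy, evalEval_finsetSum, evalEval_smul,
    evalEval_biMonomial, evalEval_zero, smul_eq_mul] at h1
  rw [hR, evalEval_artinSchreierReduce f _ hxy]
  simp only [evalEval_finsetSum, evalEval_smul, evalEval_biMonomial, smul_eq_mul]
  refine (iterateFrobenius K p μ).injective ?_
  rw [map_zero, map_sum, ← h1]
  refine sum_congr rfl fun t _ => ?_
  rw [map_mul, hb, iterateFrobenius_def, ← hP]
  rw [mul_pow, hpow, hpow]

end Stepanov

/-- Additive Hilbert 90 over `𝔽_p`: elements of trace zero are of the form `y ^ p - y`. -/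
theorem exists_pow_sub_self_eq_of_trace_eq_zero {p : ℕ} [Fact p.Prime] {K : Type*} [Field K]
    [Finite K] [Algebra (ZMod p) K] (u : K) (hu : Algebra.trace (ZMod p) K u = 0) :
    ∃ y : K, y ^ p - y = u := by
  have : CharP K p := charP_of_injective_algebraMap' (ZMod p) p
  let σ : K ≃ₐ[ZMod p] K := FiniteField.frobeniusAlgEquivOfAlgebraic (ZMod p) K
  have hσ : ∀ y, σ y = y ^ p := fun y => by
    simp [σ, ZMod.card]
  let φ : K →ₗ[ZMod p] K := σ.toLinearMap - LinearMap.id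
  have hφ : ∀ y, φ y = y ^ p - y := fun y => by simp [φ, hσ]
  have hle : LinearMap.range φ ≤ LinearMap.ker (Algebra.trace (ZMod p) K) := by
    rintro _ ⟨y, rfl⟩
    rw [LinearMap.mem_ker, hφ, map_sub, ← hσ, Algebra.trace_eq_of_algEquiv σ y, sub_self]
  have hker : Module.finrank (ZMod p) (LinearMap.ker φ) ≤ 1 := by
    have h : LinearMap.ker φ ≤ Submodule.span (ZMod p) {1} := by
      intro y hy
      have hy : y ^ p = y := by rw [← sub_eq_zero, ← hφ]; exact hy
      rw [← Subfield.mem_bot_iff_pow_eq_self K p, mem_bot_iff_intCast p K] at hy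
      obtain ⟨n, rfl⟩ := hy
      exact Submodule.mem_span_singleton.2 ⟨(n : ZMod p), by simp [Algebra.smul_def]⟩
    exact (Submodule.finrank_mono h).trans (finrank_span_singleton (K := ZMod p) (one_ne_zero (α := K))).le
  have h1 := LinearMap.finrank_range_add_finrank_ker φ
  have h2 := LinearMap.finrank_range_add_finrank_ker (Algebra.trace (ZMod p) K)
  rw [LinearMap.range_eq_top.2 (Algebra.trace_surjective (ZMod p) K), finrank_top,
    Module.finrank_self] at h2
  have h3 := Submodule.eq_of_le_of_finrank_le hle (by omega)
  have h4 : u ∈ LinearMap.range φ := h3 ▸ hu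
  obtain ⟨y, hy⟩ := h4
  exact ⟨y, (hφ y).symm.trans hy⟩

theorem norm_sum_addChar_le_of_mul_card_le {p : ℕ} [Fact p.Prime] (ψ : AddChar (ZMod p) ℂ)
    (hψ : ψ.IsPrimitive) {ι : Type*} [Fintype ι] (τ : ι → ZMod p) (E : ℕ)
    (h : ∀ a, p * (univ.filter fun x => τ x = a).card ≤ Fintype.card ι + E) :
    ‖∑ x, ψ (τ x)‖ ≤ E := by
  have hp0 : (0 : ℝ) < p := by exact_mod_cast (Fact.out : p.Prime).pos
  set N : ZMod p → ℕ := fun a => (univ.filter fun x => τ x = a).card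
  set U : ℝ := (Fintype.card ι + E) / p
  have hN : ∀ a, (N a : ℝ) ≤ U := fun a => by
    rw [le_div_iff₀' hp0]; exact_mod_cast h a
  have hsum : ∑ x, ψ (τ x) = ∑ a, ((N a : ℝ) : ℂ) * ψ a := by
    rw [← sum_fiberwise univ τ]
    refine sum_congr rfl fun a _ => ?_
    rw [sum_congr rfl fun x hx => by rw [(mem_filter.1 hx).2], sum_const, nsmul_eq_mul]
    simp [N]
  have hN1 : ∑ a, (N a : ℝ) = Fintype.card ι := by
    have := card_eq_sum_card_fiberwise (f := τ) (s := univ) (t := univ) (fun _ _ => mem_univ _)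
    exact_mod_cast this.symm
  have h0 : ∑ a, ψ a = 0 := by
    have := AddChar.sum_mulShift (1 : ZMod p) hψ
    simpa using this
  have h2 : ∑ x, ψ (τ x) = -∑ a, (((U - N a : ℝ)) : ℂ) * ψ a := by
    rw [hsum, ← add_eq_zero_iff_eq_neg, ← sum_add_distrib]
    calc _ = ∑ a, (U : ℂ) * ψ a := sum_congr rfl fun a _ => by push_cast; ring
      _ = 0 := by rw [← mul_sum, h0, mul_zero]
  rw [h2, norm_neg]
  refine (norm_sum_le _ _).trans ?_
  simp only [norm_mul, AddChar.norm_apply, mul_one, Complex.norm_real, Real.norm_eq_abs]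
  rw [sum_congr rfl fun a _ => abs_of_nonneg (sub_nonneg.2 (hN a)), sum_sub_distrib, hN1, sum_const,
    card_univ, ZMod.card, nsmul_eq_mul, mul_div_cancel₀ _ hp0.ne']
  linarith

theorem norm_sum_addChar_trace_le {p : ℕ} [Fact p.Prime] (ψ : AddChar (ZMod p) ℂ)
    (hψ : ψ.IsPrimitive) (f : Polynomial (ZMod p)) (hf : 0 < f.natDegree) (hfp : f.natDegree < p)
    {K : Type*} [Field K] [Fintype K] [Algebra (ZMod p) K] (μ : ℕ)
    (hK : Fintype.card K = (p ^ μ) ^ 2) (hμ : 2 * (f.natDegree * p) + 1 < p ^ μ) :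
    ‖∑ x : K, ψ (Algebra.trace (ZMod p) K (Polynomial.aeval x f))‖ ≤
      (3 * (f.natDegree * p) + 1) * (p : ℝ) ^ μ := by
  have : CharP K p := charP_of_injective_algebraMap' (ZMod p) p
  have h := norm_sum_addChar_le_of_mul_card_le ψ hψ
    (fun x : K => Algebra.trace (ZMod p) K (Polynomial.aeval x f))
    ((3 * (f.natDegree * p) + 1) * p ^ μ) fun a => ?_
  · exact_mod_cast h
  obtain ⟨v, hv⟩ := Algebra.trace_surjective (ZMod p) K a
  set g : Polynomial K := f.map (algebraMap (ZMod p) K) - Polynomial.C v with hg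
  have hdeg : g.natDegree = f.natDegree := by
    rw [hg, Polynomial.natDegree_sub_C, Polynomial.natDegree_map]
  have hcop : f.natDegree.Coprime p :=
    ((Nat.Prime.coprime_iff_not_dvd Fact.out).2 fun h => absurd (Nat.le_of_dvd hf h) (by omega)).symm
  rw [← hdeg] at hf hcop hμ ⊢
  rw [hK]
  refine mul_card_artinSchreier_le μ hK g hf hcop hμ _ fun x hx => ?_
  refine exists_pow_sub_self_eq_of_trace_eq_zero _ ?_
  rw [hg, Polynomial.eval_sub, Polynomial.eval_C, map_sub, hv, Polynomial.eval_map_algebraMap, sub_eq_zero]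
  exact (mem_filter.1 hx).2

/-- The power series whose `n`-th coefficient is the `n`-th power sum of the roots of `g`: the degree
of `g` minus `t` times the logarithmic derivative of the reverse of `g`. -/
noncomputable def powerSumSeries {k : Type*} [Field k] (g : Polynomial k) : PowerSeries k :=
  PowerSeries.C (g.natDegree : k) -
    PowerSeries.X * PowerSeries.derivative k g.reverse * (g.reverse : PowerSeries k)⁻¹

theorem constantCoeff_coe_reverse {k : Type*} [Field k] (g : Polynomial k) :
    PowerSeries.constantCoeff (g.reverse : PowerSeries k) = g.leadingCoeff := by
  rw [Polynomial.constantCoeff_coe, Polynomial.coeff_zero_reverse]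

theorem powerSumSeries_mul {k : Type*} [Field k] {g h : Polynomial k} (hg : g ≠ 0) (hh : h ≠ 0) :
    powerSumSeries (g * h) = powerSumSeries g + powerSumSeries h := by
  have h1 : (g.reverse : PowerSeries k) * (g.reverse : PowerSeries k)⁻¹ = 1 :=
    PowerSeries.mul_inv_cancel _ (by rw [constantCoeff_coe_reverse]; simpa)
  have h2 : (h.reverse : PowerSeries k) * (h.reverse : PowerSeries k)⁻¹ = 1 :=
    PowerSeries.mul_inv_cancel _ (by rw [constantCoeff_coe_reverse]; simpa)
  simp only [powerSumSeries]
  rw [Polynomial.reverse_mul_of_domain, Polynomial.natDegree_mul hg hh, Polynomial.coe_mul,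
    Derivation.leibniz, PowerSeries.mul_inv_rev, Nat.cast_add, map_add, smul_eq_mul, smul_eq_mul]
  linear_combination (-PowerSeries.X * PowerSeries.derivative k h.reverse *
      (h.reverse : PowerSeries k)⁻¹) * h1 -
    (PowerSeries.X * PowerSeries.derivative k g.reverse * (g.reverse : PowerSeries k)⁻¹) * h2

theorem powerSumSeries_one {k : Type*} [Field k] : powerSumSeries (1 : Polynomial k) = 0 := by
  have h := powerSumSeries_mul (one_ne_zero (α := Polynomial k)) one_ne_zero
  rw [mul_one] at h
  simpa using h

theorem powerSumSeries_X_sub_C {k : Type*} [Field k] (α : k) :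
    powerSumSeries (Polynomial.X - Polynomial.C α) = PowerSeries.mk fun n => α ^ n := by
  have hr : ((Polynomial.X - Polynomial.C α).reverse : PowerSeries k) =
      1 - PowerSeries.C α * PowerSeries.X := by
    have : (Polynomial.X - Polynomial.C α).reverse = 1 - Polynomial.C α * Polynomial.X := by
      rw [Polynomial.reverse, Polynomial.natDegree_X_sub_C, Polynomial.reflect_sub,
        Polynomial.reflect_one_X, Polynomial.reflect_C, pow_one]
    rw [this]
    simp
  have h1 : (1 - PowerSeries.C α * PowerSeries.X : PowerSeries k) * PowerSeries.mk (fun n => α ^ n) =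
      1 := by
    ext n
    cases n with
    | zero => simp
    | succ n => simp [sub_mul, mul_assoc, PowerSeries.coeff_succ_X_mul, PowerSeries.coeff_one, pow_succ']
  have h2 : (1 - PowerSeries.C α * PowerSeries.X : PowerSeries k)⁻¹ = PowerSeries.mk fun n => α ^ n :=
    (PowerSeries.inv_eq_iff_mul_eq_one (by simp)).2 (by rw [mul_comm]; exact h1)
  rw [powerSumSeries, hr, h2, Polynomial.natDegree_X_sub_C]
  have h3 : PowerSeries.derivative k (1 - PowerSeries.C α * PowerSeries.X : PowerSeries k) =
      -PowerSeries.C α := by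
    rw [map_sub, Derivation.leibniz]
    simp
  rw [h3, Nat.cast_one, map_one]
  linear_combination -h1

theorem powerSumSeries_map {k K : Type*} [Field k] [Field K] (φ : k →+* K) (g : Polynomial k) :
    powerSumSeries (g.map φ) = PowerSeries.map φ (powerSumSeries g) := by
  have hr : (g.map φ).reverse = g.reverse.map φ := by
    rw [Polynomial.reverse, Polynomial.reverse, Polynomial.natDegree_map, Polynomial.reflect_map]
  have hc : ((g.reverse.map φ : Polynomial K) : PowerSeries K) = PowerSeries.map φ g.reverse :=
    Polynomial.polynomial_map_coe
  have hi : ∀ r : PowerSeries k, PowerSeries.map φ r⁻¹ = (PowerSeries.map φ r)⁻¹ := by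
    intro r
    have hφ : PowerSeries.constantCoeff (PowerSeries.map φ r) = φ (PowerSeries.constantCoeff r) := by
      rw [← PowerSeries.coeff_zero_eq_constantCoeff_apply, PowerSeries.coeff_map,
        PowerSeries.coeff_zero_eq_constantCoeff_apply]
    by_cases h : PowerSeries.constantCoeff r = 0
    · rw [PowerSeries.inv_eq_zero.2 h, map_zero, PowerSeries.inv_eq_zero.2 (by rw [hφ, h, map_zero])]
    · rw [eq_comm, PowerSeries.inv_eq_iff_mul_eq_one, ← map_mul, PowerSeries.inv_mul_cancel _ h, map_one]
      rwa [hφ, Ne, map_eq_zero]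
  simp only [powerSumSeries, hr, hc, Polynomial.natDegree_map, map_sub, map_mul, hi,
    PowerSeries.map_X, map_natCast]
  rw [← hc, PowerSeries.derivative_coe, PowerSeries.derivative_coe, Polynomial.derivative_map,
    Polynomial.polynomial_map_coe]

theorem coeff_powerSumSeries_add_X_pow {k : Type*} [Field k] {g g' : Polynomial k} {m d : ℕ}
    (hg : g.Monic) (hm : g.natDegree = m) (hg' : g'.Monic) (hm' : g'.natDegree = m) (hd : 0 < d)
    (hdm : d ≤ m) (δ : k) (h : g' = g + Polynomial.C δ * Polynomial.X ^ (m - d)) {j : ℕ}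
    (hj : j ≤ d) :
    (powerSumSeries g').coeff j = (powerSumSeries g).coeff j - if j = d then d * δ else 0 := by
  have hr : g'.reverse = g.reverse + Polynomial.C δ * Polynomial.X ^ d := by
    rw [Polynomial.reverse, Polynomial.reverse, hm, hm', h, Polynomial.reflect_add,
      Polynomial.reflect_C_mul_X_pow, Polynomial.revAt_le (Nat.sub_le m d), Nat.sub_sub_self hdm]
  have hr' : (g'.reverse : PowerSeries k) =
      (g.reverse : PowerSeries k) + PowerSeries.C δ * PowerSeries.X ^ d := by
    rw [hr]; simp
  have h1 : (g.reverse : PowerSeries k) * (g.reverse : PowerSeries k)⁻¹ = 1 :=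
    PowerSeries.mul_inv_cancel _ (by rw [constantCoeff_coe_reverse]; simp [hg])
  have h2 : (g'.reverse : PowerSeries k) * (g'.reverse : PowerSeries k)⁻¹ = 1 :=
    PowerSeries.mul_inv_cancel _ (by rw [constantCoeff_coe_reverse]; simp [hg'])
  have hder : PowerSeries.X * PowerSeries.derivative k g'.reverse = PowerSeries.X *
      PowerSeries.derivative k g.reverse + PowerSeries.C (d * δ) * PowerSeries.X ^ d := by
    rw [hr', map_add, Derivation.leibniz, PowerSeries.derivative_pow]
    obtain ⟨e, rfl⟩ := Nat.exists_eq_add_of_lt hd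
    simp
    ring
  set W := (g.reverse : PowerSeries k)⁻¹ * (PowerSeries.C δ * (PowerSeries.C (d : k) -
    PowerSeries.X * PowerSeries.derivative k g'.reverse * (g'.reverse : PowerSeries k)⁻¹)) with hW
  have key : powerSumSeries g' = powerSumSeries g - PowerSeries.X ^ d * W := by
    simp only [powerSumSeries, hm, hm', hW]
    rw [map_mul] at hder
    generalize PowerSeries.X * PowerSeries.derivative k g'.reverse = a' at *
    generalize PowerSeries.X * PowerSeries.derivative k g.reverse = a at *
    generalize (g.reverse : PowerSeries k)⁻¹ = i at *
    generalize (g'.reverse : PowerSeries k)⁻¹ = i' at *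
    generalize (g.reverse : PowerSeries k) = r at *
    generalize (g'.reverse : PowerSeries k) = r' at *
    linear_combination -i * hder + a' * i * i' * hr' + a' * i' * h1 - a' * i * h2
  rw [key, map_sub, PowerSeries.coeff_X_pow_mul']
  congr 1
  by_cases hjd : j = d
  · subst hjd
    simp only [le_refl, if_true, Nat.sub_self, PowerSeries.coeff_zero_eq_constantCoeff, hW, map_mul, map_sub]
    simp [PowerSeries.constantCoeff_inv, hg.leadingCoeff, mul_comm]
  · rw [if_neg (by omega), if_neg hjd]

theorem finite_setOf_monic_natDegree_eq (k : Type*) [Field k] [Finite k] (m : ℕ) :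
    {g : Polynomial k | g.Monic ∧ g.natDegree = m}.Finite := by
  refine Set.Finite.of_injOn (f := fun g (i : Fin (m + 1)) => g.coeff i) (t := Set.univ)
    (fun _ _ => Set.mem_univ _) ?_ Set.finite_univ
  rintro g ⟨-, hg⟩ h ⟨-, hh⟩ hgh
  ext i
  rcases lt_or_ge i (m + 1) with hi | hi
  · exact congrFun hgh ⟨i, hi⟩
  · rw [Polynomial.coeff_eq_zero_of_natDegree_lt (by omega),
      Polynomial.coeff_eq_zero_of_natDegree_lt (by omega)]

/-- The monic polynomials of degree `m` over a finite field. -/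
noncomputable def monicsOfDegree (k : Type*) [Field k] [Finite k] (m : ℕ) :
    Finset (Polynomial k) :=
  (finite_setOf_monic_natDegree_eq k m).toFinset

theorem mem_monicsOfDegree {k : Type*} [Field k] [Finite k] {m : ℕ} {g : Polynomial k} :
    g ∈ monicsOfDegree k m ↔ g.Monic ∧ g.natDegree = m := by
  simp [monicsOfDegree]

/-- The sum of `f` over the roots of `g` (in a splitting field, with multiplicity). -/
noncomputable def rootSum {k : Type*} [Field k] (f g : Polynomial k) : k :=
  ∑ j ∈ range (f.natDegree + 1), f.coeff j * (powerSumSeries g).coeff j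

theorem rootSum_one {k : Type*} [Field k] (f : Polynomial k) : rootSum f 1 = 0 := by
  simp [rootSum, powerSumSeries_one]

theorem rootSum_mul {k : Type*} [Field k] (f : Polynomial k) {g h : Polynomial k} (hg : g ≠ 0)
    (hh : h ≠ 0) : rootSum f (g * h) = rootSum f g + rootSum f h := by
  simp [rootSum, powerSumSeries_mul hg hh, mul_add, sum_add_distrib]

theorem rootSum_pow {k : Type*} [Field k] (f : Polynomial k) {g : Polynomial k} (hg : g ≠ 0)
    (n : ℕ) : rootSum f (g ^ n) = n • rootSum f g := by
  induction n with
  | zero => simp [rootSum_one]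
  | succ n ih => rw [pow_succ, rootSum_mul f (pow_ne_zero _ hg) hg, ih, succ_nsmul]

theorem rootSum_X_sub_C {k : Type*} [Field k] (f : Polynomial k) (α : k) :
    rootSum f (Polynomial.X - Polynomial.C α) = f.eval α := by
  simp [rootSum, powerSumSeries_X_sub_C, Polynomial.eval_eq_sum_range]

theorem rootSum_add_X_pow {k : Type*} [Field k] (f : Polynomial k) {g g' : Polynomial k} {m : ℕ}
    (hg : g.Monic) (hm : g.natDegree = m) (hg' : g'.Monic) (hm' : g'.natDegree = m)
    (hf : 0 < f.natDegree) (hfm : f.natDegree ≤ m) (δ : k)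
    (h : g' = g + Polynomial.C δ * Polynomial.X ^ (m - f.natDegree)) :
    rootSum f g' = rootSum f g - f.leadingCoeff * (f.natDegree * δ) := by
  rw [rootSum, sum_congr rfl fun j hj => by
    rw [coeff_powerSumSeries_add_X_pow hg hm hg' hm' hf hfm δ h
      (Nat.lt_succ_iff.1 (mem_range.1 hj))]]
  simp only [mul_sub, sum_sub_distrib, mul_ite, mul_zero]
  rw [sum_ite_eq' (range (f.natDegree + 1)), if_pos (self_mem_range_succ _)]
  rfl

/-- The `m`-th coefficient of the `L`-function of the exponential sum attached to `ψ` and `f`. -/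
noncomputable def lCoeff {k : Type*} [Field k] [Finite k] (ψ : AddChar k ℂ) (f : Polynomial k)
    (m : ℕ) : ℂ :=
  ∑ g ∈ monicsOfDegree k m, ψ (rootSum f g)

theorem lCoeff_zero {k : Type*} [Field k] [Finite k] (ψ : AddChar k ℂ) (f : Polynomial k) :
    lCoeff ψ f 0 = 1 := by
  have : monicsOfDegree k 0 = {1} := by
    ext g
    rw [mem_monicsOfDegree, mem_singleton]
    constructor
    · rintro ⟨hg, h0⟩; exact hg.natDegree_eq_zero.1 h0
    · rintro rfl; simp
  simp [lCoeff, this, rootSum_one]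

theorem lCoeff_one {k : Type*} [Field k] [Fintype k] (ψ : AddChar k ℂ) (f : Polynomial k) :
    lCoeff ψ f 1 = ∑ x, ψ (f.eval x) := by
  symm
  refine sum_bij (fun x _ => Polynomial.X - Polynomial.C x) (fun x _ => ?_) (fun x _ y _ h => ?_)
    (fun g hg => ?_) fun x _ => by rw [rootSum_X_sub_C]
  · exact mem_monicsOfDegree.2 ⟨Polynomial.monic_X_sub_C x, Polynomial.natDegree_X_sub_C x⟩
  · exact Polynomial.C_injective (sub_right_injective h)
  · obtain ⟨hg, h1⟩ := mem_monicsOfDegree.1 hg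
    refine ⟨-g.coeff 0, mem_univ _, ?_⟩
    have := Polynomial.eq_X_add_C_of_natDegree_le_one h1.le
    rw [show g.coeff 1 = 1 by rw [← h1]; exact hg] at this
    conv_rhs => rw [this]
    simp

theorem lCoeff_eq_zero {p : ℕ} [Fact p.Prime] {ψ : AddChar (ZMod p) ℂ} (hψ : ψ.IsPrimitive)
    {f : Polynomial (ZMod p)} (h0 : 0 < f.natDegree) (hp : f.natDegree < p) {m : ℕ}
    (hm : f.natDegree ≤ m) : lCoeff ψ f m = 0 := by
  have hshift : ∀ δ : ZMod p,
      lCoeff ψ f m = lCoeff ψ f m * ψ (-(f.leadingCoeff * (f.natDegree * δ))) := by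
    intro δ
    have hmem : ∀ (ε : ZMod p) (g : Polynomial (ZMod p)), g ∈ monicsOfDegree (ZMod p) m →
        g + Polynomial.C ε * Polynomial.X ^ (m - f.natDegree) ∈ monicsOfDegree (ZMod p) m := by
      intro ε g hg
      rw [mem_monicsOfDegree] at hg ⊢
      have hdeg : (Polynomial.C ε * Polynomial.X ^ (m - f.natDegree)).degree < g.degree := by
        refine (Polynomial.degree_C_mul_X_pow_le _ _).trans_lt ?_
        rw [Polynomial.degree_eq_natDegree hg.1.ne_zero, hg.2]
        exact_mod_cast Nat.sub_lt (by omega) h0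
      exact ⟨hg.1.add_of_left hdeg, by
        rw [Polynomial.natDegree_add_eq_left_of_degree_lt hdeg, hg.2]⟩
    rw [lCoeff, sum_mul]
    symm
    refine sum_bij' (fun g _ => g + Polynomial.C δ * Polynomial.X ^ (m - f.natDegree))
      (fun g _ => g + Polynomial.C (-δ) * Polynomial.X ^ (m - f.natDegree))
      (fun g hg => hmem _ g hg) (fun g hg => hmem _ g hg) (fun g _ => by simp) (fun g _ => by simp)
      fun g hg => ?_
    have h1 := mem_monicsOfDegree.1 hg
    have h2 := mem_monicsOfDegree.1 (hmem δ g hg)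
    rw [rootSum_add_X_pow f h1.1 h1.2 h2.1 h2.2 h0 hm δ rfl, sub_eq_add_neg, AddChar.map_add_eq_mul]
  by_contra h
  have hu : -(f.leadingCoeff * (f.natDegree : ZMod p)) ≠ 0 := by
    refine neg_ne_zero.2 (mul_ne_zero ?_ ?_)
    · rw [Ne, Polynomial.leadingCoeff_eq_zero]
      rintro rfl
      simp at h0
    · rw [Ne, ZMod.natCast_eq_zero_iff]
      exact fun hd => absurd (Nat.le_of_dvd h0 hd) (by omega)
  refine hψ hu ?_
  ext δ
  have := (mul_eq_left₀ h).1 (hshift δ).symm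
  rw [AddChar.mulShift_apply, AddChar.one_apply, ← this]
  ring_nf

/-- The monic irreducible polynomials whose degree divides `n`. -/
noncomputable def irredsOfDegreeDvd (k : Type*) [Field k] [Finite k] (n : ℕ) :
    Finset (Polynomial k) := by
  classical
  exact (n.divisors.biUnion (monicsOfDegree k)).filter Irreducible

theorem mem_irredsOfDegreeDvd {k : Type*} [Field k] [Finite k] {n : ℕ} (hn : n ≠ 0)
    {P : Polynomial k} :
    P ∈ irredsOfDegreeDvd k n ↔ P.Monic ∧ Irreducible P ∧ P.natDegree ∣ n := by
  simp [irredsOfDegreeDvd, mem_monicsOfDegree, hn]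
  tauto

/-- The `n`-th coefficient of the logarithmic derivative of the `L`-function. -/
noncomputable def lPowerSum {k : Type*} [Field k] [Finite k] (ψ : AddChar k ℂ) (f : Polynomial k)
    (n : ℕ) : ℂ :=
  ∑ P ∈ irredsOfDegreeDvd k n, P.natDegree * ψ (rootSum f (P ^ (n / P.natDegree)))

open scoped Classical in
theorem sum_natDegree_irreds_dvd {k : Type*} [Field k] [Finite k] {m : ℕ} {g : Polynomial k}
    (hgm : g ∈ monicsOfDegree k m) :
    ∑ n ∈ Icc 1 m, ∑ P ∈ irredsOfDegreeDvd k n with P ^ (n / P.natDegree) ∣ g,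
      P.natDegree = m := by
  obtain ⟨hg, rfl⟩ := mem_monicsOfDegree.1 hgm
  set M := UniqueFactorizationMonoid.normalizedFactors g
  have h1 : g.natDegree = ∑ P ∈ M.toFinset, M.count P * P.natDegree := by
    have := UniqueFactorizationMonoid.prod_normalizedFactors_eq hg.ne_zero
    rw [hg.normalize_eq_self] at this
    conv_lhs => rw [← this]
    rw [Polynomial.natDegree_multiset_prod _
      (UniqueFactorizationMonoid.zero_notMem_normalizedFactors g), sum_multiset_map_count]
    rfl
  have h2 : ∀ P : Polynomial k, P.Monic → Irreducible P → ∀ e, P ^ e ∣ g ↔ e ≤ M.count P := by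
    intro P hP hI e
    rw [← Nat.cast_le (α := ℕ∞), pow_dvd_iff_le_emultiplicity,
      UniqueFactorizationMonoid.emultiplicity_eq_count_normalizedFactors hI hg.ne_zero,
      hP.normalize_eq_self]
  have h3 : ∀ P ∈ M, P.Monic ∧ Irreducible P := by
    intro P hP
    have hI := UniqueFactorizationMonoid.irreducible_of_normalized_factor P hP
    rw [← UniqueFactorizationMonoid.normalize_normalized_factor P hP]
    exact ⟨Polynomial.monic_normalize hI.ne_zero, (associated_normalize P).irreducible hI⟩
  have h4 : ∑ P ∈ M.toFinset, M.count P * P.natDegree =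
      ∑ x ∈ M.toFinset.sigma fun P => Icc 1 (M.count P), x.1.natDegree := by
    rw [sum_sigma]
    exact sum_congr rfl fun P _ => by simp
  conv_rhs => rw [h1]
  rw [h4, sum_sigma']
  refine sum_bij' (fun x _ => ⟨x.2, x.1 / x.2.natDegree⟩) (fun x _ => ⟨x.2 * x.1.natDegree, x.1⟩)
    (fun ⟨n, P⟩ hx => ?_) (fun ⟨P, e⟩ hx => ?_) (fun ⟨n, P⟩ hx => ?_) (fun ⟨P, e⟩ hx => ?_)
    (fun _ _ => rfl)
  · rw [mem_sigma, mem_Icc, mem_filter] at hx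
    obtain ⟨⟨hn, -⟩, hP, hd⟩ := hx
    obtain ⟨hP, hI, hdn⟩ := (mem_irredsOfDegreeDvd (by omega)).1 hP
    have he : 1 ≤ n / P.natDegree := Nat.div_pos (Nat.le_of_dvd hn hdn) hI.natDegree_pos
    have := (h2 P hP hI _).1 hd
    rw [mem_sigma, mem_Icc, Multiset.mem_toFinset, ← Multiset.one_le_count_iff_mem]
    exact ⟨he.trans this, he, this⟩
  · rw [mem_sigma, mem_Icc, Multiset.mem_toFinset] at hx
    obtain ⟨hM, he, hc⟩ := hx
    obtain ⟨hP, hI⟩ := h3 P hM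
    have h5 := (h2 P hP hI e).2 hc
    have h6 := Polynomial.natDegree_le_of_dvd h5 hg.ne_zero
    rw [Polynomial.natDegree_pow] at h6
    have h7 : 0 < e * P.natDegree := Nat.mul_pos he hI.natDegree_pos
    rw [mem_sigma, mem_Icc, mem_filter, mem_irredsOfDegreeDvd h7.ne']
    refine ⟨⟨h7, h6⟩, ⟨hP, hI, dvd_mul_left _ _⟩, ?_⟩
    dsimp only
    rwa [Nat.mul_div_cancel _ hI.natDegree_pos]
  · rw [mem_sigma, mem_Icc, mem_filter] at hx
    have := ((mem_irredsOfDegreeDvd (by omega)).1 hx.2.1).2.2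
    dsimp only
    rw [Nat.div_mul_cancel this]
  · rw [mem_sigma, Multiset.mem_toFinset] at hx
    dsimp only
    rw [Nat.mul_div_cancel _ (h3 P hx.1).2.natDegree_pos]

theorem sum_addChar_rootSum_filter_dvd {k : Type*} [Field k] [Finite k] (ψ : AddChar k ℂ)
    (f : Polynomial k) {P : Polynomial k} (hP : P.Monic) {m : ℕ} (hm : P.natDegree ≤ m)
    [DecidablePred (P ∣ ·)] :
    ∑ g ∈ monicsOfDegree k m with P ∣ g, ψ (rootSum f g) =
      ψ (rootSum f P) * lCoeff ψ f (m - P.natDegree) := by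
  rw [lCoeff, mul_sum]
  symm
  refine sum_bij (fun g _ => P * g) (fun g hg => ?_) (fun g _ h _ hgh => ?_) (fun g hg => ?_)
    fun g hg => ?_
  · obtain ⟨hg, hd⟩ := mem_monicsOfDegree.1 hg
    rw [mem_filter, mem_monicsOfDegree]
    refine ⟨⟨hP.mul hg, ?_⟩, dvd_mul_right _ _⟩
    rw [hP.natDegree_mul hg]
    omega
  · exact mul_left_cancel₀ hP.ne_zero hgh
  · obtain ⟨hg, h, rfl⟩ := mem_filter.1 hg
    obtain ⟨hg, hd⟩ := mem_monicsOfDegree.1 hg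
    have hh := hP.of_mul_monic_left hg
    refine ⟨h, mem_monicsOfDegree.2 ⟨hh, ?_⟩, rfl⟩
    rw [hP.natDegree_mul hh] at hd
    omega
  · rw [rootSum_mul f hP.ne_zero (mem_monicsOfDegree.1 hg).1.ne_zero, AddChar.map_add_eq_mul]

theorem mul_lCoeff_eq_sum {k : Type*} [Field k] [Finite k] (ψ : AddChar k ℂ) (f : Polynomial k)
    (m : ℕ) : m * lCoeff ψ f m = ∑ n ∈ Icc 1 m, lPowerSum ψ f n * lCoeff ψ f (m - n) := by
  classical
  have h : ∀ g ∈ monicsOfDegree k m, (m : ℂ) * ψ (rootSum f g) = ∑ n ∈ Icc 1 m,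
      ∑ P ∈ irredsOfDegreeDvd k n, P.natDegree *
        if P ^ (n / P.natDegree) ∣ g then ψ (rootSum f g) else 0 := by
    intro g hg
    conv_lhs => rw [← sum_natDegree_irreds_dvd hg]
    push_cast
    rw [sum_mul]
    refine sum_congr rfl fun n _ => ?_
    rw [sum_mul, sum_filter]
    exact sum_congr rfl fun P _ => by split_ifs <;> simp
  rw [lCoeff, mul_sum, sum_congr rfl h, sum_comm]
  refine sum_congr rfl fun n hn => ?_
  rw [sum_comm, lPowerSum, sum_mul]
  refine sum_congr rfl fun P hP => ?_
  rw [mem_Icc] at hn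
  obtain ⟨hP, -, hd⟩ := (mem_irredsOfDegreeDvd (by omega)).1 hP
  have hdeg : (P ^ (n / P.natDegree)).natDegree = n := by
    rw [hP.natDegree_pow, Nat.div_mul_cancel hd]
  rw [← mul_sum, ← sum_filter, sum_addChar_rootSum_filter_dvd ψ f (hP.pow _) (by omega), hdeg,
    mul_assoc]

theorem coeff_powerSumSeries_of_splits {k : Type*} [Field k] {g : Polynomial k} (hg : g.Monic)
    (hs : g.Splits) (n : ℕ) : (powerSumSeries g).coeff n = (g.roots.map (· ^ n)).sum := by
  have h : ∀ s : Multiset k, (powerSumSeries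
      (s.map fun a => Polynomial.X - Polynomial.C a).prod).coeff n = (s.map (· ^ n)).sum := by
    intro s
    induction s using Multiset.induction_on with
    | empty => simp [powerSumSeries_one]
    | cons a s ih =>
      rw [Multiset.map_cons, Multiset.prod_cons, powerSumSeries_mul (Polynomial.X_sub_C_ne_zero a)
        (Polynomial.monic_multiset_prod_of_monic s _ fun a _ => Polynomial.monic_X_sub_C a).ne_zero,
        map_add, ih, powerSumSeries_X_sub_C]
      simp
  conv_lhs => rw [hs.eq_prod_roots_of_monic hg]
  exact h _

theorem algebraMap_rootSum {k E : Type*} [Field k] [Field E] [Algebra k E] (f : Polynomial k)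
    {g : Polynomial k} (hg : g.Monic) (hs : (g.map (algebraMap k E)).Splits) :
    algebraMap k E (rootSum f g) = ((g.aroots E).map fun a => Polynomial.aeval a f).sum := by
  have h : ∀ j, algebraMap k E ((powerSumSeries g).coeff j) = ((g.aroots E).map (· ^ j)).sum := by
    intro j
    rw [Polynomial.aroots, ← coeff_powerSumSeries_of_splits (hg.map _) hs, powerSumSeries_map,
      PowerSeries.coeff_map]
  simp only [rootSum, map_sum, map_mul, h, Polynomial.aeval_eq_sum_range, Algebra.smul_def]
  rw [Multiset.sum_map_sum]
  simp only [Multiset.sum_map_mul_left]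

theorem trace_aeval_eq_rootSum {F K : Type*} [Field F] [Finite F] [Field K] [Finite K]
    [Algebra F K] (f : Polynomial F) (x : K) :
    Algebra.trace F K (Polynomial.aeval x f) =
      rootSum f (minpoly F x ^ (Module.finrank F K / (minpoly F x).natDegree)) := by
  have hx : IsIntegral F x := .of_finite F x
  set L := IntermediateField.adjoin F {x}
  let y : L := IntermediateField.AdjoinSimple.gen F x
  have hy : Polynomial.aeval x f = algebraMap L K (Polynomial.aeval y f) := by
    rw [← Polynomial.aeval_algebraMap_apply]; rfl
  have hdeg : Module.finrank F K / (minpoly F x).natDegree = Module.finrank L K := by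
    rw [← Module.finrank_mul_finrank F L K, IntermediateField.adjoin.finrank hx,
      Nat.mul_div_cancel_left _ (minpoly.natDegree_pos hx)]
  have htr : Algebra.trace F L (Polynomial.aeval y f) = rootSum f (minpoly F x) := by
    apply (algebraMap F (AlgebraicClosure F)).injective
    rw [trace_eq_sum_embeddings, algebraMap_rootSum f (minpoly.monic hx) (IsAlgClosed.splits _)]
    classical
    have hnd : ((minpoly F x).aroots (AlgebraicClosure F)).Nodup :=
      Polynomial.nodup_roots ((Polynomial.separable_map _).mpr (Algebra.IsSeparable.isSeparable F x))
    rw [← Multiset.dedup_eq_self.2 hnd, ← Multiset.toFinset_val]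
    rw [show ∀ s : Finset (AlgebraicClosure F), (s.val.map fun a => Polynomial.aeval a f).sum =
      ∑ a ∈ s, Polynomial.aeval a f from fun _ => rfl]
    rw [← Finset.sum_coe_sort ((minpoly F x).aroots (AlgebraicClosure F)).toFinset]
    refine Fintype.sum_equiv ((IntermediateField.algHomAdjoinIntegralEquiv F hx).trans
      (Equiv.subtypeEquivRight fun a => Multiset.mem_toFinset.symm)) _ _ fun σ => ?_
    obtain ⟨a, rfl⟩ := (IntermediateField.algHomAdjoinIntegralEquiv F hx).symm.surjective σ
    simp only [← Polynomial.aeval_algHom_apply, Equiv.trans_apply, Equiv.apply_symm_apply,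
      Equiv.subtypeEquivRight_apply_coe]
    exact congrArg (Polynomial.aeval · f)
      (IntermediateField.algHomAdjoinIntegralEquiv_symm_apply_gen F hx a)
  rw [hy, ← Algebra.trace_trace (S := L), Algebra.trace_algebraMap, map_nsmul, htr, hdeg,
    rootSum_pow f (minpoly.ne_zero hx)]

theorem card_filter_minpoly_eq {F K : Type*} [Field F] [Finite F] [Field K] [Fintype K]
    [Algebra F K] [DecidableEq (Polynomial F)] {P : Polynomial F} (hP : P.Monic)
    (hI : Irreducible P) (hd : P.natDegree ∣ Module.finrank F K) :
    (univ.filter fun x : K => minpoly F x = P).card = P.natDegree := by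
  have : Fact (Irreducible P) := ⟨hI⟩
  have hfr : Module.finrank F (AdjoinRoot P) = P.natDegree := by
    rw [(AdjoinRoot.powerBasis hI.ne_zero).finrank, AdjoinRoot.powerBasis_dim]
  obtain ⟨φ⟩ := FiniteField.nonempty_algHom_of_finrank_dvd (F := F) (K := AdjoinRoot P) (L := K)
    (hfr.symm ▸ hd)
  have hroot : Polynomial.aeval (φ (AdjoinRoot.root P)) P = 0 := by
    rw [Polynomial.aeval_algHom_apply, AdjoinRoot.aeval_eq, AdjoinRoot.mk_self, map_zero]
  have hmin := (minpoly.eq_of_irreducible_of_monic hI hroot hP)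
  have hs : (P.map (algebraMap F K)).Splits := by
    rw [hmin]; exact Normal.splits' _
  have hsep : P.Separable := PerfectField.separable_of_irreducible hI
  rw [← Polynomial.card_rootSet_eq_natDegree hsep hs, ← Set.toFinset_card]
  congr 1
  ext x
  rw [mem_filter, Set.mem_toFinset, Polynomial.mem_rootSet]
  constructor
  · rintro ⟨-, rfl⟩; exact ⟨hP.ne_zero, minpoly.aeval F x⟩
  · rintro ⟨-, hx⟩; exact ⟨mem_univ _, (minpoly.eq_of_irreducible_of_monic hI hx hP).symm⟩

theorem lPowerSum_eq_sum_trace {F K : Type*} [Field F] [Finite F] [Field K] [Fintype K]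
    [Algebra F K] (ψ : AddChar F ℂ) (f : Polynomial F) :
    lPowerSum ψ f (Module.finrank F K) =
      ∑ x : K, ψ (Algebra.trace F K (Polynomial.aeval x f)) := by
  classical
  have hn : Module.finrank F K ≠ 0 := Module.finrank_pos.ne'
  rw [← sum_fiberwise_of_maps_to (g := minpoly F) (t := irredsOfDegreeDvd F (Module.finrank F K))
    fun x _ => ?_, lPowerSum]
  · refine sum_congr rfl fun P hP => ?_
    obtain ⟨hP, hI, hd⟩ := (mem_irredsOfDegreeDvd hn).1 hP
    rw [sum_congr rfl fun x hx => by rw [trace_aeval_eq_rootSum, (mem_filter.1 hx).2], sum_const,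
      card_filter_minpoly_eq hP hI hd, nsmul_eq_mul]
  · have hx : IsIntegral F x := .of_finite F x
    exact (mem_irredsOfDegreeDvd hn).2 ⟨minpoly.monic hx, minpoly.irreducible hx, minpoly.degree_dvd hx⟩

theorem coeff_mul_powerSum_eq {a s : ℕ → ℂ}
    (h : ∀ m : ℕ, m * a m = ∑ n ∈ Icc 1 m, s n * a (m - n)) :
    PowerSeries.X * PowerSeries.derivative ℂ (PowerSeries.mk a) =
      (PowerSeries.mk fun n => if n = 0 then 0 else s n) * PowerSeries.mk a := by
  ext m
  have h1 : (PowerSeries.X * PowerSeries.derivative ℂ (PowerSeries.mk a)).coeff m = m * a m := by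
    cases m with
    | zero => simp
    | succ m =>
      rw [PowerSeries.coeff_succ_X_mul, PowerSeries.coeff_derivative, PowerSeries.coeff_mk,
        mul_comm]
      push_cast
      rfl
  rw [h1, h, PowerSeries.coeff_mul, Finset.Nat.sum_antidiagonal_eq_sum_range_succ_mk,
    sum_range_succ']
  simp only [PowerSeries.coeff_mk, if_pos, zero_mul, add_zero]
  rw [show Icc 1 m = Ico 1 (m + 1) from rfl, sum_Ico_eq_sum_range, Nat.add_sub_cancel]
  exact sum_congr rfl fun i _ => by rw [if_neg (Nat.succ_ne_zero i), add_comm 1 i]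

theorem exists_multiset_powerSum {a s : ℕ → ℂ} {N : ℕ}
    (h : ∀ m : ℕ, m * a m = ∑ n ∈ Icc 1 m, s n * a (m - n)) (h0 : a 0 = 1)
    (hN : ∀ m, N < m → a m = 0) :
    ∃ W : Multiset ℂ, W.card = N ∧ ∀ n, n ≠ 0 → s n = -(W.map (· ^ n)).sum := by
  set R : Polynomial ℂ := ∑ m ∈ range (N + 1), Polynomial.C (a m) * Polynomial.X ^ m with hR
  have hcoeff : ∀ m, R.coeff m = a m := by
    intro m
    rw [hR, Polynomial.finsetSum_coeff]
    simp only [Polynomial.coeff_C_mul_X_pow]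
    rw [sum_ite_eq]
    split_ifs with hm
    · rfl
    · rw [hN m (by simpa using hm)]
  have hRs : (R : PowerSeries ℂ) = PowerSeries.mk a := by
    ext m; rw [Polynomial.coeff_coe, hcoeff, PowerSeries.coeff_mk]
  have hRdeg : R.natDegree ≤ N := Polynomial.natDegree_le_iff_coeff_eq_zero.2 fun m hm => by
    rw [hcoeff, hN m hm]
  set Q := R.reflect N with hQ
  have hQN : Q.coeff N = 1 := by
    rw [hQ, Polynomial.coeff_reflect, Polynomial.revAt_le le_rfl, Nat.sub_self, hcoeff, h0]
  have hQdeg : Q.natDegree = N := by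
    refine le_antisymm (Polynomial.natDegree_reflect_le.trans (max_le le_rfl hRdeg))
      (Polynomial.le_natDegree_of_ne_zero (by rw [hQN]; exact one_ne_zero))
  have hQm : Q.Monic := by rw [Polynomial.Monic, Polynomial.leadingCoeff, hQdeg, hQN]
  have hrev : Q.reverse = R := by rw [Polynomial.reverse, hQdeg, hQ, Polynomial.reflect_reflect]
  have hinv : (R : PowerSeries ℂ) * (R : PowerSeries ℂ)⁻¹ = 1 :=
    PowerSeries.mul_inv_cancel _ (by rw [Polynomial.constantCoeff_coe, hcoeff, h0]; simp)
  refine ⟨Q.roots, ?_, fun n hn => ?_⟩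
  · rw [← (IsAlgClosed.splits Q).natDegree_eq_card_roots, hQdeg]
  · rw [← coeff_powerSumSeries_of_splits hQm (IsAlgClosed.splits Q), powerSumSeries, hrev]
    rw [hRs] at hinv ⊢
    rw [coeff_mul_powerSum_eq h, mul_assoc, hinv, mul_one, map_sub, PowerSeries.coeff_C, if_neg hn,
      PowerSeries.coeff_mk, if_neg hn]
    ring

theorem norm_le_one_of_norm_powerSum_le {Z : Multiset ℂ} {C : ℝ} {n₀ : ℕ}
    (h : ∀ n, n₀ ≤ n → ‖(Z.map (· ^ n)).sum‖ ≤ C) {z : ℂ} (hz : z ∈ Z) : ‖z‖ ≤ 1 := by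
  classical
  set q : Polynomial ℂ := ∏ w ∈ Z.toFinset.erase z, (Polynomial.X - Polynomial.C w)
  have hqz : q.eval z ≠ 0 := by
    rw [Polynomial.eval_prod, prod_ne_zero_iff]
    intro w hw
    simpa [sub_eq_zero] using (ne_of_mem_erase hw).symm
  have hq : ∀ w ∈ Z.toFinset, w ≠ z → q.eval w = 0 := by
    intro w hw hwz
    rw [Polynomial.eval_prod, prod_eq_zero (mem_erase.2 ⟨hwz, hw⟩)]
    simp
  have hsum : ∀ n, (∑ j ∈ range (q.natDegree + 1), q.coeff j * (Z.map (· ^ (n + j))).sum) =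
      Z.count z * q.eval z * z ^ n := by
    intro n
    simp only [sum_multiset_map_count, mul_sum]
    rw [sum_comm, sum_eq_single z]
    · rw [Polynomial.eval_eq_sum_range, mul_sum, sum_mul]
      exact sum_congr rfl fun j _ => by rw [nsmul_eq_mul, pow_add]; ring
    · intro w hw hwz
      calc _ = Z.count w * q.eval w * w ^ n := by
            rw [Polynomial.eval_eq_sum_range, mul_sum, sum_mul]
            exact sum_congr rfl fun j _ => by rw [nsmul_eq_mul, pow_add]; ring
        _ = 0 := by rw [hq w hw hwz]; ring
    · intro hz'; exact absurd (Multiset.mem_toFinset.2 hz) hz'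
  set c : ℝ := ‖(Z.count z * q.eval z : ℂ)‖
  have hc : 0 < c := norm_pos_iff.2 (mul_ne_zero
    (Nat.cast_ne_zero.2 (Multiset.count_ne_zero.2 hz)) hqz)
  have hb : ∀ n, n₀ ≤ n → c * ‖z‖ ^ n ≤ ∑ j ∈ range (q.natDegree + 1), ‖q.coeff j‖ * C := by
    intro n hn
    rw [← norm_pow, ← norm_mul, ← hsum]
    refine (norm_sum_le _ _).trans (sum_le_sum fun j _ => ?_)
    rw [norm_mul]
    exact mul_le_mul_of_nonneg_left (h _ (by omega)) (norm_nonneg _)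
  by_contra! h1
  obtain ⟨n, hn⟩ := ((tendsto_pow_atTop_atTop_of_one_lt h1).eventually_gt_atTop
    ((∑ j ∈ range (q.natDegree + 1), ‖q.coeff j‖ * C) / c)).and
      (Filter.eventually_ge_atTop n₀) |>.exists
  rw [div_lt_iff₀' hc] at hn
  exact absurd (hb n hn.2) (not_le.2 hn.1)

/-- The Weil bound for additive character sums of a polynomial over a prime field. -/
theorem weil_bound {p : ℕ} [Fact p.Prime] (ψ : AddChar (ZMod p) ℂ) (hψ : ψ.IsPrimitive)
    (f : Polynomial (ZMod p)) (h0 : 0 < f.natDegree) (hp : f.natDegree < p) :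
    ‖∑ x, ψ (f.eval x)‖ ≤ ((f.natDegree : ℝ) - 1) * Real.sqrt p := by
  have hp1 : 1 < p := (Fact.out : p.Prime).one_lt
  have hp0 : (0 : ℝ) < p := by exact_mod_cast hp1.le
  obtain ⟨W, hW, hs⟩ := exists_multiset_powerSum (mul_lCoeff_eq_sum ψ f) (lCoeff_zero ψ f)
    (N := f.natDegree - 1) fun m hm => lCoeff_eq_zero hψ h0 hp (by omega)
  obtain ⟨n₀, hn₀⟩ := pow_unbounded_of_one_lt (2 * (f.natDegree * p) + 1) hp1
  have hbound : ∀ n, n₀ + 1 ≤ n → ‖((W.map fun w => w ^ 2 / (p : ℂ)).map (· ^ n)).sum‖ ≤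
      3 * (f.natDegree * p) + 1 := by
    intro n hn
    have hK : 2 * n ≠ 0 := by omega
    let : Fintype (GaloisField p (2 * n)) := Fintype.ofFinite _
    have h1 := norm_sum_addChar_trace_le ψ hψ f h0 hp (K := GaloisField p (2 * n)) n
      (by rw [Fintype.card_eq_nat_card, GaloisField.card p _ hK, mul_comm, pow_mul])
      (hn₀.trans_le (Nat.pow_le_pow_right hp1.le (by omega)))
    rw [← lPowerSum_eq_sum_trace, GaloisField.finrank p hK, hs _ hK, norm_neg] at h1
    have h2 : ((W.map fun w => w ^ 2 / (p : ℂ)).map (· ^ n)).sum =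
        (W.map (· ^ (2 * n))).sum / (p : ℂ) ^ n := by
      rw [Multiset.map_map, ← Multiset.sum_map_div]
      simp [div_pow, pow_mul]
    rw [h2, norm_div, norm_pow, Complex.norm_natCast, div_le_iff₀ (by positivity)]
    exact h1
  have hle : ∀ w ∈ W, ‖w‖ ≤ Real.sqrt p := by
    intro w hw
    have := norm_le_one_of_norm_powerSum_le hbound (Multiset.mem_map_of_mem _ hw)
    rw [norm_div, norm_pow, Complex.norm_natCast, div_le_one hp0] at this
    exact Real.le_sqrt_of_sq_le this
  have h1 : ∑ x, ψ (f.eval x) = -W.sum := by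
    have := mul_lCoeff_eq_sum ψ f 1
    rw [lCoeff_one] at this
    simpa [lCoeff_zero, hs 1 one_ne_zero] using this
  rw [h1, norm_neg]
  refine (norm_multiset_sum_le W).trans ?_
  refine (Multiset.sum_le_card_nsmul _ (Real.sqrt p) fun y hy => ?_).trans ?_
  · obtain ⟨w, hw, rfl⟩ := Multiset.mem_map.1 hy
    exact hle w hw
  · rw [Multiset.card_map, hW, nsmul_eq_mul, Nat.cast_sub h0, Nat.cast_one]

theorem realChoose_mono {x y : ℝ} {k : ℕ} (hx : (k : ℝ) - 1 ≤ x) (hxy : x ≤ y) :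
    realChoose x k ≤ realChoose y k := by
  unfold realChoose
  refine div_le_div_of_nonneg_right (prod_le_prod (fun j hj => ?_) fun j hj => ?_) (by positivity)
  · have : j + 1 ≤ k := mem_range.1 hj
    have : (j : ℝ) + 1 ≤ k := by exact_mod_cast this
    linarith
  · linarith

theorem realChoose_natCast (n k : ℕ) : realChoose n k = n.choose k := by
  have h : (n.descFactorial k : ℝ) = k.factorial * n.choose k := by
    exact_mod_cast Nat.descFactorial_eq_factorial_mul_choose n k
  rw [realChoose, ← descPochhammer_eval_eq_prod_range, descPochhammer_eval_eq_descFactorial, h,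
    mul_div_cancel_left₀ _ (by positivity)]

theorem succ_mul_realChoose (M : ℝ) (k : ℕ) :
    ((k + 1 : ℕ) : ℝ) * realChoose (M + (k + 1 : ℕ) - 1) (k + 1) =
      (M + k) * realChoose (M + k - 1) k := by
  unfold realChoose
  rw [prod_range_succ', Nat.factorial_succ]
  have : ∀ j ∈ range k, M + ((k + 1 : ℕ) : ℝ) - 1 - ((j + 1 : ℕ) : ℝ) = M + k - 1 - j := by
    intros; push_cast; ring
  rw [prod_congr rfl this]
  push_cast
  field_simp
  ring

theorem mul_realChoose_eq_sum (M : ℝ) (k : ℕ) :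
    (k : ℝ) * realChoose (M + k - 1) k = M * ∑ i ∈ range k, realChoose (M + i - 1) i := by
  induction k with
  | zero => simp
  | succ k ih => rw [succ_mul_realChoose, sum_range_succ, mul_add, ← ih]; ring

theorem mul_esymm_eq_sum_antidiagonal {ι : Type*} [DecidableEq ι] (D : Finset ι) (z : ι → ℂ) (k : ℕ) :
    (k : ℂ) * ∑ S ∈ D.powersetCard k, ∏ x ∈ S, z x = (-1) ^ (k + 1) *
      ∑ a ∈ (HasAntidiagonal.antidiagonal k).filter (fun a => a.1 < k),
        (-1) ^ a.1 * (∑ S ∈ D.powersetCard a.1, ∏ x ∈ S, z x) * ∑ x ∈ D, z x ^ a.2 := by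
  have h := congrArg (MvPolynomial.aeval (fun i : D => z i)) (MvPolynomial.mul_esymm_eq_sum D ℂ k)
  have e : ∀ n, (Multiset.map (fun i : D => z i) univ.val).esymm n =
      ∑ S ∈ D.powersetCard n, ∏ x ∈ S, z x := by
    intro n
    rw [← Finset.esymm_map_val]
    congr 1
    exact Multiset.attach_map_val' D.val z
  have e2 : ∀ n, ∑ i : D, z i ^ n = ∑ x ∈ D, z x ^ n := fun n => by
    exact Finset.sum_coe_sort D (fun x => z x ^ n)
  simpa only [map_mul, map_sum, map_pow, map_neg, map_one, map_natCast, MvPolynomial.aeval_X,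
    MvPolynomial.aeval_esymm_eq_multiset_esymm, MvPolynomial.psum, e, e2] using h

theorem norm_esymm_le {ι : Type*} [DecidableEq ι] (D : Finset ι) (z : ι → ℂ) (M : ℝ)
    (k : ℕ) (h : ∀ j, 0 < j → j ≤ k → ‖∑ x ∈ D, z x ^ j‖ ≤ M) :
    ‖∑ S ∈ D.powersetCard k, ∏ x ∈ S, z x‖ ≤ realChoose (M + k - 1) k := by
  induction k using Nat.strong_induction_on with
  | _ k ih =>
  rcases Nat.eq_zero_or_pos k with rfl | hk
  · simp [realChoose]
  have hk' : (0 : ℝ) < k := by exact_mod_cast hk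
  refine le_of_mul_le_mul_left ?_ hk'
  rw [mul_realChoose_eq_sum]
  have h1 := congrArg norm (mul_esymm_eq_sum_antidiagonal D z k)
  rw [norm_mul, norm_mul, norm_pow, norm_neg, norm_one, one_pow, one_mul, Complex.norm_natCast] at h1
  rw [h1, mul_sum]
  refine (norm_sum_le _ _).trans ?_
  have h2 : (HasAntidiagonal.antidiagonal k).filter (fun a => a.1 < k) = (range k).image (fun i => (i, k - i)) := by
    ext ⟨a, b⟩
    simp only [mem_filter, HasAntidiagonal.mem_antidiagonal, mem_image, mem_range, Prod.mk.injEq]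
    constructor
    · rintro ⟨h1, h2⟩; exact ⟨a, h2, rfl, by omega⟩
    · rintro ⟨i, h1, rfl, rfl⟩; omega
  rw [h2, sum_image (by intro a _ b _ h; simpa using congrArg Prod.fst h)]
  refine sum_le_sum fun i hi => ?_
  rw [mem_range] at hi
  rw [norm_mul, norm_mul, norm_pow, norm_neg, norm_one, one_pow, one_mul, mul_comm]
  have := ih i hi fun j hj hji => h j hj (by omega)
  exact mul_le_mul (h _ (by omega) (by omega)) this (norm_nonneg _)
    ((norm_nonneg _).trans (h k hk le_rfl))

theorem AddChar.map_sum_eq_prod_map {ι A M : Type*} [AddCommMonoid A] [CommMonoid M]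
    (ψ : AddChar A M) (s : Finset ι) (g : ι → A) : ψ (∑ i ∈ s, g i) = ∏ i ∈ s, ψ (g i) := by
  classical
  induction s using Finset.induction_on with
  | empty => simp
  | insert i s hi ih => rw [sum_insert hi, prod_insert hi, AddChar.map_add_eq_mul, ih]

theorem card_mul_polySubsetSumCount {p : ℕ} [Fact p.Prime] (ψ : AddChar (ZMod p) ℂ)
    (hψ : ψ.IsPrimitive) (f : Polynomial (ZMod p)) (D : Finset (ZMod p)) (k : ℕ) (b : ZMod p) :
    (p : ℂ) * polySubsetSumCount D f k b =
      ∑ a : ZMod p, ψ (-(a * b)) * ∑ S ∈ D.powersetCard k, ∏ x ∈ S, ψ (a * f.eval x) := by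
  have h : ∀ S : Finset (ZMod p), ∑ a : ZMod p, ψ (-(a * b)) * ∏ x ∈ S, ψ (a * f.eval x) =
      if ∑ x ∈ S, f.eval x = b then (p : ℂ) else 0 := by
    intro S
    have := AddChar.sum_mulShift (∑ x ∈ S, f.eval x - b) hψ
    simp only [ZMod.card, sub_eq_zero, Nat.cast_ite, Nat.cast_zero] at this
    rw [← this]
    refine sum_congr rfl fun a _ => ?_
    rw [← AddChar.map_sum_eq_prod_map, ← AddChar.map_add_eq_mul, ← mul_sum]
    congr 1; ring
  simp_rw [mul_sum]
  rw [sum_comm]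
  simp_rw [h, ← sum_filter, sum_const, polySubsetSumCount, nsmul_eq_mul, mul_comm]

theorem norm_powerSum_le {p : ℕ} [Fact p.Prime] (ψ : AddChar (ZMod p) ℂ) (f : Polynomial (ZMod p))
    (D : Finset (ZMod p)) (B : ℝ) (c : ℕ) (hc : (D.card : ℝ) = p - c)
    (hB : ‖∑ x, ψ (f.eval x)‖ ≤ B) : ‖∑ x ∈ D, ψ (f.eval x)‖ ≤ B + c := by
  have h := sum_add_sum_compl D fun x => ψ (f.eval x)
  have h2 : ‖∑ x ∈ Dᶜ, ψ (f.eval x)‖ ≤ c := by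
    refine (norm_sum_le _ _).trans ?_
    simp only [AddChar.norm_apply, sum_const, nsmul_eq_mul, mul_one]
    have := card_add_card_compl D
    rw [ZMod.card] at this
    have : (D.card : ℝ) + (Dᶜ.card : ℝ) = p := by exact_mod_cast this
    linarith
  rw [eq_sub_of_add_eq h]
  exact (norm_sub_le _ _).trans (add_le_add hB h2)

theorem norm_esymm_addChar_le {p : ℕ} [Fact p.Prime] (ψ : AddChar (ZMod p) ℂ) (hψ : ψ.IsPrimitive)
    (f : Polynomial (ZMod p)) (h0 : 0 < f.natDegree) (hp : f.natDegree < p)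
    (D : Finset (ZMod p)) (c : ℕ) (hc : (D.card : ℝ) = p - c) (k : ℕ) (hk : k ≤ D.card)
    (a : ZMod p) (ha : a ≠ 0) :
    ‖∑ S ∈ D.powersetCard k, ∏ x ∈ S, ψ (a * f.eval x)‖ ≤
      realChoose (((f.natDegree : ℝ) - 1) * Real.sqrt p + c + k) k := by
  have hd : (1 : ℝ) ≤ f.natDegree := by exact_mod_cast h0
  have hM : 0 ≤ ((f.natDegree : ℝ) - 1) * Real.sqrt p + c :=
    add_nonneg (mul_nonneg (by linarith) (Real.sqrt_nonneg _)) (Nat.cast_nonneg c)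
  have hDp : D.card ≤ p := by simpa [ZMod.card] using card_le_univ D
  rcases (hk.trans hDp).lt_or_eq with hlt | hkp
  · refine (norm_esymm_le D _ (((f.natDegree : ℝ) - 1) * Real.sqrt p + c) k
      fun j hj hjk => ?_).trans (realChoose_mono (by linarith) (by linarith))
    have hj0 : (j : ZMod p) ≠ 0 := by
      rw [Ne, ZMod.natCast_eq_zero_iff]
      exact fun h => absurd (Nat.le_of_dvd hj h) (by omega)
    have hdeg : (Polynomial.C ((j : ZMod p) * a) * f).natDegree = f.natDegree :=
      Polynomial.natDegree_C_mul (mul_ne_zero hj0 ha)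
    have hw := weil_bound ψ hψ (Polynomial.C ((j : ZMod p) * a) * f) (by omega) (by omega)
    rw [hdeg] at hw
    convert norm_powerSum_le ψ _ D _ c hc hw using 3 with x
    rw [← AddChar.map_nsmul_eq_pow, Polynomial.eval_mul, Polynomial.eval_C, nsmul_eq_mul, mul_assoc]
  · have hcard : k = D.card := le_antisymm hk (hDp.trans hkp.ge)
    have h1 := realChoose_mono (x := (D.card : ℕ)) (k := D.card)
      (y := ((f.natDegree : ℝ) - 1) * Real.sqrt p + c + D.card) (by linarith) (by linarith)
    rw [realChoose_natCast, Nat.choose_self, Nat.cast_one] at h1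
    rw [hcard, powersetCard_self, sum_singleton, norm_prod]
    simpa only [AddChar.norm_apply, prod_const_one] using h1

/-- **Corollary (polynomial subset sums over the prime field `𝔽_p`).**
Let `f ∈ 𝔽_p[x]` have degree `d` with `0 < d < p`. If `D ⊆ 𝔽_p` with
`|D| = p - c ≥ (d-1)√p + c`, then for all `b` and `0 ≤ k ≤ |D|`,
`|N_f(D,k,b) - (1/p)·C(p-c,k)| ≤ C((d-1)·p^{1/2} + c + k, k)`. -/
theorem polySubsetSum_asymptotic_primeField
    (p : ℕ) [Fact p.Prime]
    (f : Polynomial (ZMod p)) (d : ℕ) (hdeg : f.natDegree = d) (hd : 0 < d) (hdp : d < p)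
    (D : Finset (ZMod p)) (c : ℕ) (hD : (D.card : ℝ) = (p : ℝ) - c)
    (hbig : (p : ℝ) - c ≥ ((d : ℝ) - 1) * Real.sqrt p + c)
    (b : ZMod p) (k : ℕ) (hk : k ≤ D.card) :
    |(polySubsetSumCount D f k b : ℝ)
        - (1 / (p : ℝ)) * realChoose ((p : ℝ) - c) k|
      ≤ realChoose (((d : ℝ) - 1) * Real.sqrt p + c + k) k := by
  subst hdeg
  have hp0 : (0 : ℝ) < p := by exact_mod_cast (Fact.out : p.Prime).pos
  have hψ := ZMod.isPrimitive_stdAddChar p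
  set ψ : AddChar (ZMod p) ℂ := ZMod.stdAddChar
  set B := realChoose (((f.natDegree : ℝ) - 1) * Real.sqrt p + c + k) k with hB
  have key := card_mul_polySubsetSumCount ψ hψ f D k b
  rw [← add_sum_erase _ _ (mem_univ (0 : ZMod p))] at key
  simp only [zero_mul, neg_zero, AddChar.map_zero_eq_one, prod_const_one, sum_const,
    card_powersetCard, nsmul_eq_mul, mul_one, one_mul] at key
  rw [← hD, realChoose_natCast]
  have hB0 : 0 ≤ B := (norm_nonneg _).trans
    (norm_esymm_addChar_le ψ hψ f hd hdp D c hD k hk 1 one_ne_zero)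
  have hle : ‖(p : ℂ) * polySubsetSumCount D f k b - D.card.choose k‖ ≤ p * B := by
    rw [key, add_sub_cancel_left]
    refine (norm_sum_le_of_le _ (f := _) (n := fun _ => B) fun a ha => ?_).trans ?_
    · rw [norm_mul, AddChar.norm_apply, one_mul]
      exact norm_esymm_addChar_le ψ hψ f hd hdp D c hD k hk a (ne_of_mem_erase ha)
    · rw [sum_const, nsmul_eq_mul]
      refine mul_le_mul_of_nonneg_right ?_ hB0
      have := card_le_univ ((univ : Finset (ZMod p)).erase 0)
      rw [ZMod.card] at this
      exact_mod_cast this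
  have hcast : ‖(p : ℂ) * polySubsetSumCount D f k b - D.card.choose k‖ =
      |(p : ℝ) * polySubsetSumCount D f k b - D.card.choose k| := by
    rw [← Real.norm_eq_abs, ← Complex.norm_real]; push_cast; rfl
  rw [hcast] at hle
  refine le_of_mul_le_mul_left ?_ hp0
  rw [← abs_of_pos hp0, ← abs_mul, abs_of_pos hp0, mul_sub, ← mul_assoc, mul_one_div_cancel hp0.ne',
    one_mul]
  exact hle
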